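/- arXiv:math/0504389 — 4 statements merged into one kernel-verified Lean document; each statement's English description precedes it below -/
import Mathlib

section
/- Let g be a finite-dimensional semisimple Lie algebra over a field of characteristic 0 equipped with a |k|-grading g = g_{-k} ⊕ … ⊕ g_k. Then there exists a grading element E ∈ g_0, i.e. an element E such that [E, x] = i·x for every i with -k ≤ i ≤ k and every x ∈ g_i. -/
/-- A `|k|`-grading of a Lie algebra `L` over `K`: a direct sum decomposition
`L = g₋ₖ ⊕ … ⊕ g₀ ⊕ … ⊕ gₖ` into linear subspaces (indexed by `ℤ`, with `g i = ⊥` for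
`|i| > k`) such that `⁅g i, g j⁆ ⊆ g (i+j)` and such that the negative part
`g₋ := g₋ₖ ⊕ … ⊕ g₋₁` is generated by `g₋₁`. -/
structure IsKGrading (K : Type*) [Field K] (L : Type*) [LieRing L] [LieAlgebra K L]
    (k : ℕ) (g : ℤ → Submodule K L) : Prop where
  internal : DirectSum.IsInternal g
  bot_of_abs_gt : ∀ i : ℤ, (i < -(k : ℤ) ∨ (k : ℤ) < i) → g i = ⊥
  bracket_mem : ∀ i j : ℤ, ∀ x ∈ g i, ∀ y ∈ g j, ⁅x, y⁆ ∈ g (i + j)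
  generated_by_minus_one : ∀ i : ℤ, i < -1 →
    g i = Submodule.span K {z : L | ∃ x ∈ g (-1), ∃ y ∈ g (i + 1), z = ⁅x, y⁆}

/-- A finite-dimensional semisimple `|k|`-graded Lie algebra over a field of
characteristic `0` possesses a grading element: an element `E ∈ g₀` with `⁅E, x⁆ = i • x`
for every `i` with `-k ≤ i ≤ k` and every `x ∈ gᵢ`. -/
theorem exists_grading_element
    {K : Type*} [Field K] [CharZero K] {L : Type*} [LieRing L] [LieAlgebra K L]
    [Module.Finite K L] [LieAlgebra.IsSemisimple K L]
    (k : ℕ) (g : ℤ → Submodule K L) (hg : IsKGrading K L k g) :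
    ∃ E ∈ g 0, ∀ i : ℤ, -(k : ℤ) ≤ i → i ≤ (k : ℤ) → ∀ x ∈ g i, ⁅E, x⁆ = i • x := by
  classical
  let _ : DirectSum.Decomposition g := hg.internal.chooseDecomposition
  let D : L →ₗ[K] L :=
    (DirectSum.toModule K ℤ L (fun i => (i : K) • (g i).subtype)) ∘ₗ
      (DirectSum.decomposeLinearEquiv g).toLinearMap
  have hD : ∀ i : ℤ, ∀ x ∈ g i, D x = (i : K) • x := by
    intro i x hx
    have := DirectSum.decomposeLinearEquiv_apply_coe (R := K) g i ⟨x, hx⟩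
    simp only at this
    simp only [D, LinearMap.comp_apply, LinearEquiv.coe_coe, this, DirectSum.toModule_lof]
    simp
  have hproj : ∀ x : L, ∀ i : ℤ,
      (DirectSum.decompose g (D x) i : L) = (i : K) • (DirectSum.decompose g x i : L) := by
    intro x i
    induction x using DirectSum.Decomposition.inductionOn g with
    | zero => simp
    | @homogeneous j m =>
      rw [hD j m m.2, DirectSum.decompose_smul]
      by_cases h : j = i
      · subst h
        simp [DirectSum.smul_apply]
      · simp [DirectSum.smul_apply, DirectSum.decompose_coe, DirectSum.of_eq_of_ne _ _ _ (Ne.symm h)]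
    | add a b ha hb => simp [map_add, DirectSum.decompose_add, ha, hb]
  have hleib : ∀ a b : L, D ⁅a, b⁆ = ⁅a, D b⁆ - ⁅b, D a⁆ := by
    intro a b
    induction a using DirectSum.Decomposition.inductionOn g with
    | zero => simp
    | @homogeneous i x =>
      induction b using DirectSum.Decomposition.inductionOn g with
      | zero => simp
      | @homogeneous j y =>
        rw [hD _ _ (hg.bracket_mem i j x x.2 y y.2), hD i x x.2, hD j y y.2, lie_smul, lie_smul,
          ← lie_skew (x : L) (y : L)]
        push_cast
        module
      | add c d hc hd =>
        simp only [lie_add, add_lie, map_add, hc, hd]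
        abel
    | add c d hc hd =>
      simp only [lie_add, add_lie, map_add, hc, hd]
      abel
  obtain ⟨E, hE⟩ := LieDerivation.IsKilling.exists_eq_ad (R := K) (L := L) ⟨D, hleib⟩
  have hE' : ∀ x, ⁅E, x⁆ = D x := fun x => by
    have := congrArg (fun d : LieDerivation K L L => d x) hE
    simpa using this
  refine ⟨E, ?_, ?_⟩
  · have h0 : D E = 0 := by rw [← hE', lie_self]
    have hz : ∀ i : ℤ, i ≠ 0 → (DirectSum.decompose g E i : L) = 0 := by
      intro i hi
      have := hproj E i
      rw [h0] at this
      simp only [DirectSum.decompose_zero, DirectSum.zero_apply, ZeroMemClass.coe_zero] at this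
      exact (smul_eq_zero.mp this.symm).resolve_left (Int.cast_ne_zero.mpr hi)
    have : DirectSum.decompose g E = DirectSum.of (fun i => g i) 0 (DirectSum.decompose g E 0) := by
      ext i
      by_cases hi : i = 0
      · subst hi; simp
      · rw [hz i hi, DirectSum.of_eq_of_ne _ _ _ hi]; rfl
    have h2 := congrArg (DirectSum.decompose g).symm this
    rw [Equiv.symm_apply_apply, DirectSum.decompose_symm_of] at h2
    rw [h2]
    exact SetLike.coe_mem _
  · intro i _ _ x hx
    rw [hE', hD i x hx, Int.cast_smul_eq_zsmul]
end

section
/- Let g be a finite-dimensional semisimple Lie algebra over a field of characteristic 0 equipped with a |k|-grading g = g_{-k} ⊕ … ⊕ g_k, and set p := g_0 ⊕ g_1 ⊕ … ⊕ g_k. Then the normalizer of p in g equals p; that is, if x ∈ g satisfies [x, y] ∈ p for all y ∈ p, then x ∈ p. -/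
/-- Let `L` be a finite-dimensional semisimple `|k|`-graded Lie algebra over
a field of characteristic `0` and `p := g₀ ⊕ … ⊕ gₖ` the associated parabolic subalgebra.
Then the normalizer of `p` in `L` equals `p`: an element `x : L` satisfies `⁅x, y⁆ ∈ p` for
all `y ∈ p` if and only if `x ∈ p`. -/
theorem normalizer_of_parabolic_eq_self
    {K : Type*} [Field K] [CharZero K] {L : Type*} [LieRing L] [LieAlgebra K L]
    [Module.Finite K L] [LieAlgebra.IsSemisimple K L]
    (k : ℕ) (g : ℤ → Submodule K L) (hg : IsKGrading K L k g)
    (p : Submodule K L) (hp : p = ⨆ j ∈ {j : ℤ | 0 ≤ j}, g j) :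
    ∀ x : L, (∀ y ∈ p, ⁅x, y⁆ ∈ p) ↔ x ∈ p := by
  classical
  letI : DirectSum.Decomposition g := hg.internal.chooseDecomposition
  have hmem : ∀ i : ℤ, 0 ≤ i → g i ≤ p := by
    intro i hi
    rw [hp]
    exact le_iSup₂_of_le i hi le_rfl
  have hpneg : ∀ x ∈ p, ∀ j : ℤ, j < 0 → (DirectSum.decompose g x j : L) = 0 := by
    intro x hx j hj
    let π : L →ₗ[K] L := (g j).subtype ∘ₗ (DirectSum.component K ℤ (fun i => g i) j) ∘ₗ
      (DirectSum.decomposeLinearEquiv g).toLinearMap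
    have hle : p ≤ LinearMap.ker π := by
      rw [hp]
      refine iSup₂_le fun i hi y hy => ?_
      have hi' : 0 ≤ i := hi
      have : (DirectSum.decompose g y j : L) = 0 :=
        DirectSum.decompose_of_mem_ne g hy (by omega)
      exact this
    exact hle hx
  have hpof : ∀ x : L, (∀ j : ℤ, j < 0 → (DirectSum.decompose g x j : L) = 0) → x ∈ p := by
    intro x hx
    rw [← DirectSum.sum_support_decompose g x]
    refine Submodule.sum_mem _ fun i _ => ?_
    by_cases hi : 0 ≤ i
    · exact hmem i hi (SetLike.coe_mem _)
    · rw [hx i (by omega)]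
      exact p.zero_mem
  let D₀ : L →ₗ[K] L := (DirectSum.toModule K ℤ L (fun i => (i : K) • (g i).subtype)) ∘ₗ
      (DirectSum.decomposeLinearEquiv g).toLinearMap
  have hD₀ : ∀ (i : ℤ) (x : L), x ∈ g i → D₀ x = (i : K) • x := by
    intro i x hx
    change DirectSum.toModule K ℤ L (fun i => (i : K) • (g i).subtype) (DirectSum.decompose g x) = _
    rw [DirectSum.decompose_of_mem g hx]
    exact DirectSum.toModule_lof (M := fun i => g i) (φ := fun i => (i : K) • (g i).subtype) K i ⟨x, hx⟩
  have hcomp : ∀ (x : L) (i : ℤ),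
      (DirectSum.decompose g (D₀ x) i : L) = (i : K) • (DirectSum.decompose g x i : L) := by
    intro x i
    induction x using DirectSum.Decomposition.inductionOn g with
    | zero => simp
    | @homogeneous j m =>
      rw [hD₀ j m m.2]
      by_cases h : j = i
      · subst h
        rw [DirectSum.decompose_of_mem_same g ((g j).smul_mem _ m.2),
          DirectSum.decompose_of_mem_same g m.2]
      · rw [DirectSum.decompose_of_mem_ne g ((g j).smul_mem _ m.2) h,
          DirectSum.decompose_of_mem_ne g m.2 h, smul_zero]
    | add m m' h h' =>
      simp only [map_add, DirectSum.decompose_add, DirectSum.add_apply, Submodule.coe_add, h, h',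
        smul_add]
  have hleib : ∀ a b : L, D₀ ⁅a, b⁆ = ⁅a, D₀ b⁆ - ⁅b, D₀ a⁆ := by
    intro a b
    induction a using DirectSum.Decomposition.inductionOn g with
    | zero => simp
    | @homogeneous i m =>
      induction b using DirectSum.Decomposition.inductionOn g with
      | zero => simp
      | @homogeneous j n =>
        rw [hD₀ _ _ (hg.bracket_mem i j m m.2 n n.2), hD₀ i m m.2, hD₀ j n n.2, lie_smul, lie_smul,
          ← lie_skew (m : L) (n : L), Int.cast_add]
        module
      | add n n' h h' =>
        simp only [lie_add, add_lie, map_add, h, h']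
        abel
    | add m m' h h' =>
      simp only [lie_add, add_lie, map_add, h, h']
      abel
  let D : LieDerivation K L L := ⟨D₀, hleib⟩
  obtain ⟨E, hE⟩ := LieDerivation.IsKilling.exists_eq_ad D
  have hE' : ∀ x, D₀ x = ⁅E, x⁆ := by
    intro x
    have : D x = ⁅E, x⁆ := by rw [← hE]; simp
    exact this
  have key : ∀ x : L, D₀ x ∈ p → x ∈ p := by
    intro x hx
    refine hpof x fun j hj => ?_
    have h := hpneg _ hx j hj
    rw [hcomp] at h
    exact (smul_eq_zero.mp h).resolve_left (by exact_mod_cast hj.ne)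
  have hEp : E ∈ p := key E (by rw [hE', lie_self]; exact p.zero_mem)
  intro x
  constructor
  · intro h
    refine key x ?_
    rw [hE', ← lie_skew]
    exact p.neg_mem (h E hEp)
  · intro hx y hy
    rw [← DirectSum.sum_support_decompose g x, ← DirectSum.sum_support_decompose g y,
      sum_lie]
    refine Submodule.sum_mem _ fun i _ => ?_
    rw [lie_sum]
    refine Submodule.sum_mem _ fun j _ => ?_
    by_cases hi : 0 ≤ i
    · by_cases hj : 0 ≤ j
      · exact hmem _ (add_nonneg hi hj) (hg.bracket_mem i j _ (SetLike.coe_mem _) _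
          (SetLike.coe_mem _))
      · rw [hpneg y hy j (by omega), lie_zero]
        exact p.zero_mem
    · rw [hpneg x hx i (by omega), zero_lie]
      exact p.zero_mem
end

section
/- Let g be a finite-dimensional semisimple Lie algebra over a field of characteristic 0 equipped with a |k|-grading g = g_{-k} ⊕ … ⊕ g_k, and assume that no nonzero simple ideal of g is contained in g_0. Then the adjoint action of g_0 on g_{-1} is faithful: if x ∈ g_0 satisfies [x, y] = 0 for all y ∈ g_{-1}, then x = 0. -/
/-- Let `L` be a finite-dimensional semisimple `|k|`-graded Lie algebra over
a field of characteristic `0` and assume that no nonzero simple ideal of `L` is contained in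
`g₀`.  Then the adjoint action of `g₀` on `g₋₁` is faithful: if `x ∈ g₀` satisfies
`⁅x, y⁆ = 0` for all `y ∈ g₋₁`, then `x = 0`. -/
theorem adjoint_action_of_g0_on_gminus1_faithful
    {K : Type*} [Field K] [CharZero K] {L : Type*} [LieRing L] [LieAlgebra K L]
    [Module.Finite K L] [LieAlgebra.IsSemisimple K L]
    (k : ℕ) (g : ℤ → Submodule K L) (hg : IsKGrading K L k g)
    (hsimple : ∀ I : LieIdeal K L, I ≠ ⊥ → LieAlgebra.IsSimple K ↥I →
      ¬ ((I : Submodule K L) ≤ g 0)) :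
    ∀ x ∈ g 0, (∀ y ∈ g (-1), ⁅x, y⁆ = 0) → x = 0 := by
  have hkill : LieAlgebra.IsKilling K L := inferInstance
  have htop : ∀ v : L, v ∈ ⨆ i, g i := fun v => by
    rw [hg.internal.submodule_iSup_eq_top]; trivial
  -- orthogonality of the graded pieces
  have horth : ∀ i j : ℤ, i + j ≠ 0 → ∀ u ∈ g i, ∀ v ∈ g j, killingForm K L u v = 0 := by
    intro i j hij u hu v hv
    rw [killingForm_apply_apply]
    refine LinearMap.trace_eq_zero_of_mapsTo_ne hg.internal (fun m => i + (j + m))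
      (fun m => by omega) ?_
    intro m w hw
    exact hg.bracket_mem _ _ _ hu _ (hg.bracket_mem _ _ _ hv _ hw)
  -- elements killing `g (-1)` kill the whole negative part
  have hneg : ∀ x ∈ g 0, (∀ y ∈ g (-1), ⁅x, y⁆ = 0) →
      ∀ n : ℕ, ∀ y ∈ g (-1 - (n : ℤ)), ⁅x, y⁆ = 0 := by
    intro x _ hx n
    induction n with
    | zero => simpa using hx
    | succ n ih =>
      intro y hy
      rw [hg.generated_by_minus_one _ (by push_cast; omega)] at hy
      induction hy using Submodule.span_induction with
      | mem z hz =>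
        obtain ⟨a, ha, b, hb, rfl⟩ := hz
        have hb' : b ∈ g (-1 - (n : ℤ)) := by
          convert hb using 2; push_cast; ring
        rw [leibniz_lie, hx a ha, ih b hb']; simp
      | zero => simp
      | add a b _ _ ha hb => rw [lie_add, ha, hb, add_zero]
      | smul c a _ ha => rw [lie_smul, ha, smul_zero]
  have hne : ∀ x ∈ g 0, (∀ y ∈ g (-1), ⁅x, y⁆ = 0) →
      ∀ i : ℤ, i ≠ 0 → ∀ y ∈ g i, ⁅x, y⁆ = 0 := by
    intro x hx0 hx i hi y hy
    have hneg' : ∀ i : ℤ, i < 0 → ∀ y ∈ g i, ⁅x, y⁆ = 0 := by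
      intro i hi y hy
      refine hneg x hx0 hx (-1 - i).toNat y ?_
      convert hy using 2; omega
    rcases lt_or_gt_of_ne hi with h | h
    · exact hneg' i h y hy
    · refine (LieAlgebra.IsKilling.killingForm_nondegenerate K L).1 _ fun v => ?_
      induction htop v using Submodule.iSup_induction' with
      | mem j w hw =>
        by_cases hj : i + j = 0
        · have := LieModule.traceForm_apply_lie_apply' K L L x y w
          rw [hneg' j (by omega) w hw] at this
          simpa using this
        · exact horth (0 + i) j (by omega) _ (hg.bracket_mem _ _ _ hx0 _ hy) _ hw
      | zero => simp
      | add a b _ _ ha hb => rw [map_add, ha, hb, add_zero]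
  let I : LieIdeal K L :=
    { carrier := {x | x ∈ g 0 ∧ ∀ y ∈ g (-1), ⁅x, y⁆ = 0}
      add_mem' := by
        rintro a b ⟨ha, ha'⟩ ⟨hb, hb'⟩
        exact ⟨add_mem ha hb, fun y hy => by rw [add_lie, ha' y hy, hb' y hy, add_zero]⟩
      zero_mem' := ⟨zero_mem _, fun y _ => zero_lie y⟩
      smul_mem' := by
        rintro c a ⟨ha, ha'⟩
        exact ⟨Submodule.smul_mem _ c ha, fun y hy => by rw [smul_lie, ha' y hy, smul_zero]⟩
      lie_mem := by
        rintro u x ⟨hx, hx'⟩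
        change ⁅u, x⁆ ∈ g 0 ∧ ∀ y ∈ g (-1), ⁅⁅u, x⁆, y⁆ = 0
        induction htop u using Submodule.iSup_induction' with
        | mem j w hw =>
          by_cases hj : j = 0
          · subst hj
            refine ⟨by simpa using hg.bracket_mem _ _ _ hw _ hx, fun y hy => ?_⟩
            have hwy : ⁅w, y⁆ ∈ g (-1) := by simpa using hg.bracket_mem _ _ _ hw _ hy
            rw [lie_lie, hx' y hy, hx' _ hwy]; simp
          · have h0 : ⁅w, x⁆ = 0 := by
              rw [← lie_skew, hne x hx hx' j hj w hw, neg_zero]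
            rw [h0]
            exact ⟨zero_mem _, fun y _ => zero_lie y⟩
        | zero => rw [zero_lie]; exact ⟨zero_mem _, fun y _ => zero_lie y⟩
        | add a b _ _ ha hb =>
          rw [add_lie]
          exact ⟨add_mem ha.1 hb.1, fun y hy => by
            rw [add_lie, ha.2 y hy, hb.2 y hy, add_zero]⟩ }
  have hI : I = ⊥ := by
    rcases eq_bot_or_exists_atom_le I with h | ⟨J, hJ, hJI⟩
    · exact h
    · exact absurd (fun z hz => (hJI hz).1)
        (hsimple J hJ.1 (LieAlgebra.IsSemisimple.isSimple_of_isAtom J hJ))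
  intro x hx hx'
  have hxI : x ∈ I := ⟨hx, hx'⟩
  rw [hI] at hxI
  simpa using hxI
end

section
/- Let n ≥ 1 and let h be the standard nondegenerate Hermitian form of signature (p, q) on V = ℂ^n (p + q = n), and let B(v, w) := Re h(v, w) be its real part. Then every ℝ-linear endomorphism f of V which is skew-symmetric with respect to B (i.e. B(f v, w) + B(v, f w) = 0 for all v, w) decomposes uniquely as f = f_0 + i t·id + f_c, where f_0 is a complex linear endomorphism with h(f_0 v, w) + h(v, f_0 w) = 0 and complex trace 0, t is a real number, and f_c is a conjugate-linear map satisfying B(f_c v, w) + B(v, f_c w) = 0. (This realizes the decomposition of so(V_ℝ, B) as su(V) ⊕ ℝ ⊕ Λ²_ℂ V as representations of SU(V, h).) -/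
lemma skewdec_map_smul {n : ℕ} (f : (Fin n → ℂ) →ₗ[ℝ] (Fin n → ℂ)) (c : ℂ) (v : Fin n → ℂ) :
    f (c • v) = (c.re : ℂ) • f v + (c.im : ℂ) • f (Complex.I • v) := by
  have hc : c • v = c.re • v + c.im • (Complex.I • v) := by
    ext j
    simp only [Pi.add_apply, Pi.smul_apply, smul_eq_mul, Complex.real_smul]
    conv_lhs => rw [← Complex.re_add_im c]
    ring
  rw [hc, map_add, map_smul, map_smul]
  ext j
  simp

lemma skewdec_map_I_smul {n : ℕ} (f : (Fin n → ℂ) →ₗ[ℝ] (Fin n → ℂ)) (c : ℂ) (v : Fin n → ℂ) :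
    f (Complex.I • c • v) = (c.re : ℂ) • f (Complex.I • v) - (c.im : ℂ) • f v := by
  rw [smul_smul, skewdec_map_smul]
  simp only [Complex.mul_re, Complex.mul_im, Complex.I_re, Complex.I_im]
  ext j
  simp
  ring

/-- The complex linear part of a real linear endomorphism. -/
noncomputable def skewdecLin {n : ℕ} (f : (Fin n → ℂ) →ₗ[ℝ] (Fin n → ℂ)) :
    (Fin n → ℂ) →ₗ[ℂ] (Fin n → ℂ) where
  toFun v := (1 / 2 : ℂ) • (f v - Complex.I • f (Complex.I • v))
  map_add' v w := by
    ext j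
    simp
    ring
  map_smul' c v := by
    rw [skewdec_map_I_smul, skewdec_map_smul]
    ext j
    simp only [Pi.add_apply, Pi.smul_apply, Pi.sub_apply, smul_eq_mul, RingHom.id_apply]
    conv_rhs => rw [← Complex.re_add_im c]
    linear_combination (-1 / 2 : ℂ) * (c.im : ℂ) * f (Complex.I • v) j * (-Complex.I_sq)

/-- The conjugate-linear part of a real linear endomorphism. -/
noncomputable def skewdecConj {n : ℕ} (f : (Fin n → ℂ) →ₗ[ℝ] (Fin n → ℂ)) :
    (Fin n → ℂ) →ₗ[ℝ] (Fin n → ℂ) where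
  toFun v := (1 / 2 : ℂ) • (f v + Complex.I • f (Complex.I • v))
  map_add' v w := by
    ext j
    simp
    ring
  map_smul' c v := by
    rw [smul_comm Complex.I c v, map_smul, map_smul]
    ext j
    simp
    ring

lemma skewdecConj_smul {n : ℕ} (f : (Fin n → ℂ) →ₗ[ℝ] (Fin n → ℂ)) (c : ℂ) (v : Fin n → ℂ) :
    skewdecConj f (c • v) = (starRingEnd ℂ) c • skewdecConj f v := by
  change (1 / 2 : ℂ) • (f (c • v) + Complex.I • f (Complex.I • c • v)) =
    (starRingEnd ℂ) c • (1 / 2 : ℂ) • (f v + Complex.I • f (Complex.I • v))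
  rw [skewdec_map_I_smul, skewdec_map_smul]
  have hc : (starRingEnd ℂ) c = (c.re : ℂ) - c.im * Complex.I := by
    apply Complex.ext <;> simp
  rw [hc]
  ext j
  simp only [Pi.add_apply, Pi.smul_apply, Pi.sub_apply, smul_eq_mul]
  linear_combination (1 / 2 : ℂ) * (c.im : ℂ) * f (Complex.I • v) j * (Complex.I_sq)

lemma skewdecLin_unique {n : ℕ} (f : (Fin n → ℂ) →ₗ[ℝ] (Fin n → ℂ))
    (L : (Fin n → ℂ) →ₗ[ℂ] (Fin n → ℂ)) (C : (Fin n → ℂ) →ₗ[ℝ] (Fin n → ℂ))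
    (hC : ∀ (c : ℂ) (v : Fin n → ℂ), C (c • v) = (starRingEnd ℂ) c • C v)
    (hf : ∀ v, f v = L v + C v) : L = skewdecLin f := by
  refine LinearMap.ext fun v => ?_
  change L v = (1 / 2 : ℂ) • (f v - Complex.I • f (Complex.I • v))
  rw [hf, hf, hC, map_smul]
  ext j
  simp only [Pi.add_apply, Pi.smul_apply, Pi.sub_apply, smul_eq_mul, Complex.conj_I]
  linear_combination (1 / 2 : ℂ) * (L v j - C v j) * Complex.I_sq

lemma skewdec_trace {n : ℕ} (L : (Fin n → ℂ) →ₗ[ℂ] (Fin n → ℂ)) :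
    LinearMap.trace ℂ (Fin n → ℂ) L = ∑ j, L (Pi.single j 1) j := by
  rw [LinearMap.trace_eq_matrix_trace ℂ (Pi.basisFun ℂ (Fin n)), Matrix.trace]
  simp


/-- Let `h` be the standard Hermitian form of signature `(p, q)` on
`V = ℂ^n` (`p + q = n`, `n ≥ 1`) and `B = Re h`.  Every `ℝ`-linear endomorphism `f` of `V`
which is skew-symmetric for `B` decomposes uniquely as `f = f₀ + i t · id + f_c`, where `f₀`
is complex linear, skew-Hermitian for `h` and of complex trace `0`, `t` is a real number,
and `f_c` is conjugate-linear and skew-symmetric for `B`.  (This realizes the decomposition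
`so(V_ℝ, B) = su(V) ⊕ ℝ ⊕ Λ²_ℂ V` as representations of `SU(V, h)`.) -/
theorem skew_endomorphism_decomposition (n p q : ℕ) (hn : 1 ≤ n) (hpq : p + q = n)
    (h : (Fin n → ℂ) → (Fin n → ℂ) → ℂ)
    (hh : ∀ v w : Fin n → ℂ,
      h v w = ∑ j : Fin n,
        if (j : ℕ) < p then (starRingEnd ℂ) (v j) * w j
        else -((starRingEnd ℂ) (v j) * w j))
    (f : (Fin n → ℂ) →ₗ[ℝ] (Fin n → ℂ))
    (hf : ∀ v w : Fin n → ℂ, (h (f v) w).re + (h v (f w)).re = 0) :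
    ∃ (f₀ : (Fin n → ℂ) →ₗ[ℂ] (Fin n → ℂ)) (t : ℝ)
      (fc : (Fin n → ℂ) →ₗ[ℝ] (Fin n → ℂ)),
      ((∀ v w : Fin n → ℂ, h (f₀ v) w + h v (f₀ w) = 0) ∧
        LinearMap.trace ℂ (Fin n → ℂ) f₀ = 0 ∧
        (∀ (c : ℂ) (v : Fin n → ℂ), fc (c • v) = (starRingEnd ℂ) c • fc v) ∧
        (∀ v w : Fin n → ℂ, (h (fc v) w).re + (h v (fc w)).re = 0) ∧
        (∀ v : Fin n → ℂ, f v = f₀ v + t • (Complex.I • v) + fc v)) ∧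
      ∀ (f₀' : (Fin n → ℂ) →ₗ[ℂ] (Fin n → ℂ)) (t' : ℝ)
        (fc' : (Fin n → ℂ) →ₗ[ℝ] (Fin n → ℂ)),
        (∀ v w : Fin n → ℂ, h (f₀' v) w + h v (f₀' w) = 0) →
        LinearMap.trace ℂ (Fin n → ℂ) f₀' = 0 →
        (∀ (c : ℂ) (v : Fin n → ℂ), fc' (c • v) = (starRingEnd ℂ) c • fc' v) →
        (∀ v w : Fin n → ℂ, (h (fc' v) w).re + (h v (fc' w)).re = 0) →
        (∀ v : Fin n → ℂ, f v = f₀' v + t' • (Complex.I • v) + fc' v) →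
        f₀' = f₀ ∧ t' = t ∧ fc' = fc := by
  have hadd : ∀ u v w, h (u + v) w = h u w + h v w := by
    intro u v w
    rw [hh, hh, hh, ← Finset.sum_add_distrib]
    refine Finset.sum_congr rfl fun j _ => ?_
    split_ifs <;> simp <;> ring
  have hadd' : ∀ u v w, h u (v + w) = h u v + h u w := by
    intro u v w
    rw [hh, hh, hh, ← Finset.sum_add_distrib]
    refine Finset.sum_congr rfl fun j _ => ?_
    split_ifs <;> simp <;> ring
  have hsm : ∀ (c : ℂ) v w, h (c • v) w = (starRingEnd ℂ) c * h v w := by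
    intro c v w
    rw [hh, hh, Finset.mul_sum]
    refine Finset.sum_congr rfl fun j _ => ?_
    split_ifs <;> simp <;> ring
  have hsm' : ∀ (c : ℂ) v w, h v (c • w) = c * h v w := by
    intro c v w
    rw [hh, hh, Finset.mul_sum]
    refine Finset.sum_congr rfl fun j _ => ?_
    split_ifs <;> simp <;> ring
  have hLC : ∀ v, f v = skewdecLin f v + skewdecConj f v := by
    intro v
    change f v = (1 / 2 : ℂ) • (f v - Complex.I • f (Complex.I • v)) +
      (1 / 2 : ℂ) • (f v + Complex.I • f (Complex.I • v))
    ext j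
    simp
    ring
  have hCskew : ∀ v w, (h (skewdecConj f v) w).re + (h v (skewdecConj f w)).re = 0 := by
    intro v w
    change (h ((1 / 2 : ℂ) • (f v + Complex.I • f (Complex.I • v))) w).re +
      (h v ((1 / 2 : ℂ) • (f w + Complex.I • f (Complex.I • w)))).re = 0
    have e1 := hf v w
    have e2 := hf (Complex.I • v) (Complex.I • w)
    have e3 : (starRingEnd ℂ) (1 / 2 : ℂ) = ((1 / 2 : ℝ) : ℂ) := by
      apply Complex.ext <;> simp
    have e4 : (1 / 2 : ℂ) = ((1 / 2 : ℝ) : ℂ) := by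
      apply Complex.ext <;> simp
    rw [hsm, hsm', e3, e4, Complex.re_ofReal_mul, Complex.re_ofReal_mul, hadd, hadd', hsm, hsm']
    rw [hsm', hsm] at e2
    simp only [Complex.conj_I, Complex.add_re, Complex.mul_re, Complex.neg_re, Complex.neg_im,
      Complex.I_re, Complex.I_im] at e2 ⊢
    linarith
  have hLre : ∀ v w, (h (skewdecLin f v) w).re + (h v (skewdecLin f w)).re = 0 := by
    intro v w
    have e1 := hf v w
    have e2 := hCskew v w
    rw [hLC v, hLC w, hadd, hadd', Complex.add_re, Complex.add_re] at e1
    linarith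
  have hLskew : ∀ v w, h (skewdecLin f v) w + h v (skewdecLin f w) = 0 := by
    intro v w
    have e1 := hLre v w
    have e2 := hLre v (Complex.I • w)
    rw [map_smul, hsm', hsm'] at e2
    simp only [Complex.mul_re, Complex.I_re, Complex.I_im] at e2
    apply Complex.ext
    · simpa using e1
    · simp only [Complex.add_im, Complex.zero_im]
      linarith
  have htr : (LinearMap.trace ℂ (Fin n → ℂ) (skewdecLin f)).re = 0 := by
    rw [skewdec_trace, Complex.re_sum]
    refine Finset.sum_eq_zero fun j _ => ?_
    have e := hLre (Pi.single j 1) (Pi.single j 1)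
    rw [hh, hh, Finset.sum_eq_single j, Finset.sum_eq_single j] at e
    · split_ifs at e <;> simp at e <;> linarith
    · intro b _ hb
      simp [hb]
    · simp
    · intro b _ hb
      simp [hb]
    · simp
  have hn0 : (n : ℝ) ≠ 0 := by
    have : n ≠ 0 := by omega
    exact_mod_cast this
  have htrid : LinearMap.trace ℂ (Fin n → ℂ) LinearMap.id = (n : ℂ) := by
    rw [LinearMap.trace_id]
    simp
  obtain ⟨t, ht⟩ : ∃ t : ℝ, LinearMap.trace ℂ (Fin n → ℂ) (skewdecLin f) =
      ((t : ℂ) * Complex.I) * n := by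
    refine ⟨(LinearMap.trace ℂ (Fin n → ℂ) (skewdecLin f)).im / n, ?_⟩
    apply Complex.ext
    · simp [htr]
    · simp [hn0]
  refine ⟨skewdecLin f - ((t : ℂ) * Complex.I) • LinearMap.id, t, skewdecConj f,
    ⟨?_, ?_, skewdecConj_smul f, hCskew, ?_⟩, ?_⟩
  · intro v w
    have e := hLskew v w
    have e1 : ∀ v, (skewdecLin f - ((t : ℂ) * Complex.I) • (LinearMap.id : (Fin n → ℂ) →ₗ[ℂ] (Fin n → ℂ))) v =
        skewdecLin f v + (-((t : ℂ) * Complex.I)) • v := by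
      intro v
      ext j
      simp
      ring
    rw [e1, e1, hadd, hadd', hsm, hsm']
    simp only [map_neg, map_mul, Complex.conj_ofReal, Complex.conj_I]
    linear_combination e
  · rw [map_sub, map_smul, htrid, ht, smul_eq_mul, sub_self]
  · intro v
    rw [hLC v]
    ext j
    simp
    ring
  · intro f₀' t' fc' _ htr' hc' _ hd'
    have hL := skewdecLin_unique f (f₀' + ((t' : ℂ) * Complex.I) • LinearMap.id) fc' hc' (by
      intro v
      rw [hd' v]
      ext j
      simp
      ring)
    have htt : t' = t := by
      rw [← hL, map_add, map_smul, htr', htrid, zero_add, smul_eq_mul] at ht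
      have := congrArg Complex.im ht
      simp at this
      exact this.resolve_right (by omega)
    subst htt
    refine ⟨?_, rfl, ?_⟩
    · rw [← hL, add_sub_cancel_right]
    · refine LinearMap.ext fun v => ?_
      have e1 := hLC v
      rw [hd' v, ← hL] at e1
      have e2 : (f₀' + ((t' : ℂ) * Complex.I) • (LinearMap.id : (Fin n → ℂ) →ₗ[ℂ] (Fin n → ℂ))) v =
          f₀' v + t' • (Complex.I • v) := by
        ext j
        simp
        ring
      rw [e2] at e1
      exact add_left_cancel e1
end
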